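/- arXiv:1201.3688 — 2 statements merged into one kernel-verified Lean document; each statement's English description precedes it below -/
import Mathlib

section
/- Let D₁₂⁺ ⊆ ℝ¹² be the set of vectors x such that (all coordinates of x are integers, or all coordinates of x lie in ℤ + 1/2) and the coordinate sum ∑_i x_i is an even integer. Then for every real y > 0, ∑_{x ∈ D₁₂⁺} e^{-π y ‖x‖²} = θ₃(y)¹² − 24 θ₃(y)⁴ Δ₈(y), where θ₃(y) = ∑_{n ∈ ℤ} e^{-π y n²} and Δ₈(y) = (1/16) θ₂(y)⁴ θ₄(y)⁴ with θ₂(y) = ∑_{n ∈ ℤ} e^{-π y (n+1/2)²} and θ₄(y) = ∑_{n ∈ ℤ} (-1)^n e^{-π y n²}. -/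
open Real

/-- θ₂ on the imaginary axis: θ₂(y) = ∑_{n ∈ ℤ} e^{-π y (n + 1/2)²}. -/
noncomputable def theta2 (y : ℝ) : ℝ := ∑' n : ℤ, Real.exp (-π * y * ((n : ℝ) + 1/2)^2)

/-- θ₃ on the imaginary axis: θ₃(y) = ∑_{n ∈ ℤ} e^{-π y n²}. -/
noncomputable def theta3 (y : ℝ) : ℝ := ∑' n : ℤ, Real.exp (-π * y * (n : ℝ)^2)

/-- θ₄ on the imaginary axis: θ₄(y) = ∑_{n ∈ ℤ} (-1)^n e^{-π y n²}. -/
noncomputable def theta4 (y : ℝ) : ℝ := ∑' n : ℤ, (-1 : ℝ) ^ n * Real.exp (-π * y * (n : ℝ)^2)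

/-- Δ₈ on the imaginary axis: Δ₈(y) = (1/16) θ₂(y)⁴ θ₄(y)⁴. -/
noncomputable def Delta8 (y : ℝ) : ℝ := (1/16 : ℝ) * theta2 y ^ 4 * theta4 y ^ 4

/-- The lattice D₁₂⁺ ⊆ ℝ¹²: vectors whose coordinates are all integers or all
half-integers, and whose coordinate sum is an even integer. -/
def D12plus : Set (EuclideanSpace ℝ (Fin 12)) :=
  {x | ((∀ i, ∃ m : ℤ, x i = (m : ℝ)) ∨ (∀ i, ∃ m : ℤ, x i = (m : ℝ) + 1/2)) ∧
    ∃ m : ℤ, (∑ i, x i) = 2 * (m : ℝ)}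

/-- The product of `n` copies of an absolutely convergent series, summed over `Fin n → ι`. -/
theorem hasSum_prod_fin_of_norm {ι : Type*} {f : ι → ℝ} {s : ℝ} (hf : HasSum f s)
    (hn : Summable fun i => ‖f i‖) (n : ℕ) :
    HasSum (fun v : Fin n → ι => ∏ i, f (v i)) (s ^ n) ∧
      Summable fun v : Fin n → ι => ‖∏ i, f (v i)‖ := by
  induction n with
  | zero =>
    refine ⟨?_, Summable.of_finite⟩
    simp
  | succ n ih =>
    have hs := hn.mul_norm ih.2
    constructor
    · rw [← (Fin.consEquiv fun _ => ι).hasSum_iff, pow_succ']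
      refine (hf.mul ih.1 hs.of_norm).congr_fun fun p => ?_
      simp [Fin.consEquiv, Fin.prod_univ_succ]
    · rw [← (Fin.consEquiv fun _ => ι).summable_iff]
      convert hs using 2 with p
      simp [Fin.consEquiv, Fin.prod_univ_succ]

theorem prod_neg_one_zpow {n : ℕ} (v : Fin n → ℤ) :
    ∏ i, (-1 : ℝ) ^ v i = (-1) ^ ∑ i, v i := by
  induction n with
  | zero => simp
  | succ n ih =>
    rw [Fin.prod_univ_succ, Fin.sum_univ_succ, zpow_add₀ (by norm_num), ih]

theorem abs_neg_one_zpow_mul (m : ℤ) (x : ℝ) : ‖(-1 : ℝ) ^ m * x‖ = ‖x‖ := by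
  rcases m.even_or_odd with h | h <;> simp [h.neg_one_zpow]

/-- Restricting a product series to integer vectors with even coordinate sum. -/
theorem hasSum_prod_even {f : ℤ → ℝ} {s t : ℝ} (hf : HasSum f s)
    (hg : HasSum (fun m => (-1) ^ m * f m) t) (hn : Summable fun m => ‖f m‖) (n : ℕ) :
    HasSum (fun v : {v : Fin n → ℤ | Even (∑ i, v i)} => ∏ i, f (v.1 i))
      ((s ^ n + t ^ n) / 2) := by
  have h := ((hasSum_prod_fin_of_norm hf hn n).1.add
    (hasSum_prod_fin_of_norm hg (by simpa only [abs_neg_one_zpow_mul] using hn) n).1).div_const 2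
  refine (hasSum_subtype_iff_indicator (f := fun v : Fin n → ℤ => ∏ i, f (v i))).2 ?_
  refine h.congr_fun fun v => ?_
  rw [Finset.prod_mul_distrib, prod_neg_one_zpow]
  by_cases hv : Even (∑ i, v i)
  · simp [Set.indicator, hv, hv.neg_one_zpow]
  · simp [Set.indicator, hv, (Int.not_even_iff_odd.1 hv).neg_one_zpow]

theorem summable_exp_shift {y : ℝ} (hy : 0 < y) (a : ℝ) :
    Summable fun n : ℤ => exp (-π * y * ((n : ℝ) + a) ^ 2) := by
  convert HurwitzKernelBounds.summable_f_int 0 a hy using 2 with n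
  simp only [HurwitzKernelBounds.f_int, pow_zero, one_mul]
  ring_nf

theorem summable_norm_exp_shift {y : ℝ} (hy : 0 < y) (a : ℝ) :
    Summable fun n : ℤ => ‖exp (-π * y * ((n : ℝ) + a) ^ 2)‖ :=
  (summable_exp_shift hy a).norm

theorem hasSum_theta2 {y : ℝ} (hy : 0 < y) :
    HasSum (fun n : ℤ => exp (-π * y * ((n : ℝ) + 1 / 2) ^ 2)) (theta2 y) :=
  (summable_exp_shift hy _).hasSum

theorem summable_theta3 {y : ℝ} (hy : 0 < y) :
    Summable fun n : ℤ => exp (-π * y * (n : ℝ) ^ 2) := by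
  simpa using summable_exp_shift hy 0

theorem hasSum_theta3 {y : ℝ} (hy : 0 < y) :
    HasSum (fun n : ℤ => exp (-π * y * (n : ℝ) ^ 2)) (theta3 y) :=
  (summable_theta3 hy).hasSum

theorem summable_norm_theta4 {y : ℝ} (hy : 0 < y) :
    Summable fun n : ℤ => ‖(-1 : ℝ) ^ n * exp (-π * y * (n : ℝ) ^ 2)‖ := by
  simpa only [abs_neg_one_zpow_mul] using (summable_theta3 hy).norm

theorem hasSum_theta4 {y : ℝ} (hy : 0 < y) :
    HasSum (fun n : ℤ => (-1 : ℝ) ^ n * exp (-π * y * (n : ℝ) ^ 2)) (theta4 y) :=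
  (summable_norm_theta4 hy).of_norm.hasSum

/-- The vanishing of the odd theta constant `θ₁(0)`. -/
theorem hasSum_theta1 {y : ℝ} (hy : 0 < y) :
    HasSum (fun n : ℤ => (-1 : ℝ) ^ n * exp (-π * y * ((n : ℝ) + 1 / 2) ^ 2)) 0 := by
  have hs : Summable fun n : ℤ => (-1 : ℝ) ^ n * exp (-π * y * ((n : ℝ) + 1 / 2) ^ 2) :=
    Summable.of_norm <| by
      simpa only [abs_neg_one_zpow_mul] using summable_norm_exp_shift hy (1 / 2)
  obtain ⟨t, ht⟩ := hs
  have h := (Equiv.subLeft (-1 : ℤ)).hasSum_iff.2 ht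
  have h' : HasSum (fun n : ℤ => (-1 : ℝ) ^ n * exp (-π * y * ((n : ℝ) + 1 / 2) ^ 2)) (-t) := by
    refine h.neg.congr_fun fun n => ?_
    simp only [Function.comp_apply, Equiv.subLeft_apply, Int.cast_sub, Int.cast_neg, Int.cast_one]
    rw [zpow_sub₀ (by norm_num), show (-1 - (n : ℝ) + 1 / 2) ^ 2 = ((n : ℝ) + 1 / 2) ^ 2 by ring]
    rcases n.even_or_odd with hn | hn <;> simp [hn.neg_one_zpow]
  have : t = -t := ht.unique h'
  rwa [show t = 0 by linarith] at ht

/-- The two cosets of the sublattice `{(m, n) | m + n even}` of `ℤ × ℤ`, each parametrized by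
sum and difference coordinates. -/
def sumDiff : (ℤ × ℤ) ⊕ (ℤ × ℤ) → ℤ × ℤ :=
  Sum.elim (fun p => (p.1 + p.2, p.1 - p.2)) fun p => (p.1 + p.2 + 1, p.1 - p.2)

theorem sumDiff_bijective : Function.Bijective sumDiff := by
  constructor
  · rintro (⟨a, b⟩ | ⟨a, b⟩) (⟨c, d⟩ | ⟨c, d⟩) h <;>
      simp only [sumDiff, Sum.elim_inl, Sum.elim_inr, Prod.mk.injEq, Sum.inl.injEq, Sum.inr.injEq,
        reduceCtorEq] at h ⊢ <;> omega
  · rintro ⟨m, n⟩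
    rcases Int.emod_two_eq_zero_or_one (m + n) with h | h
    · refine ⟨Sum.inl ((m + n) / 2, (m - n) / 2), ?_⟩
      simp only [sumDiff, Sum.elim_inl, Prod.mk.injEq]
      omega
    · refine ⟨Sum.inr ((m + n - 1) / 2, (m - n - 1) / 2), ?_⟩
      simp only [sumDiff, Sum.elim_inr, Prod.mk.injEq]
      omega

theorem sq_eq_of_hasSum_sumDiff {f : ℤ → ℝ} {s p q : ℝ} (hf : HasSum f s)
    (hn : Summable fun m => ‖f m‖)
    (hp : HasSum (fun x : ℤ × ℤ => f (x.1 + x.2) * f (x.1 - x.2)) p)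
    (hq : HasSum (fun x : ℤ × ℤ => f (x.1 + x.2 + 1) * f (x.1 - x.2)) q) :
    s ^ 2 = p + q := by
  have h := hf.mul hf (hn.mul_norm hn).of_norm
  rw [← (Equiv.ofBijective _ sumDiff_bijective).hasSum_iff] at h
  rw [sq]
  exact h.unique (HasSum.sum hp hq)

theorem hasSum_mul_of_summable {f g : ℤ → ℝ} {s t : ℝ} (hf : HasSum f s) (hg : HasSum g t) :
    HasSum (fun x : ℤ × ℤ => f x.1 * g x.2) (s * t) :=
  hf.mul hg (hf.summable.norm.mul_norm hg.summable.norm).of_norm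

theorem theta3_sq {y : ℝ} (hy : 0 < y) :
    theta3 y ^ 2 = theta3 (2 * y) ^ 2 + theta2 (2 * y) ^ 2 := by
  have h2 : 0 < 2 * y := by positivity
  refine sq_eq_of_hasSum_sumDiff (hasSum_theta3 hy) (summable_theta3 hy).norm ?_ ?_
  · rw [sq]
    convert hasSum_mul_of_summable (hasSum_theta3 h2) (hasSum_theta3 h2) using 2 with x
    rw [← exp_add, ← exp_add]
    push_cast
    ring_nf
  · rw [sq]
    convert hasSum_mul_of_summable (hasSum_theta2 h2) (hasSum_theta2 h2) using 2 with x
    rw [← exp_add, ← exp_add]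
    push_cast
    ring_nf

theorem theta4_sq {y : ℝ} (hy : 0 < y) :
    theta4 y ^ 2 = theta3 (2 * y) ^ 2 - theta2 (2 * y) ^ 2 := by
  have h2 : 0 < 2 * y := by positivity
  rw [sub_eq_add_neg]
  refine sq_eq_of_hasSum_sumDiff (hasSum_theta4 hy) (summable_norm_theta4 hy) ?_ ?_
  · rw [sq]
    convert hasSum_mul_of_summable (hasSum_theta3 h2) (hasSum_theta3 h2) using 2 with x
    rw [mul_mul_mul_comm, ← zpow_add₀ (by norm_num),
      Even.neg_one_zpow ⟨x.1, by ring⟩, one_mul, ← exp_add, ← exp_add]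
    push_cast
    ring_nf
  · rw [sq]
    refine (hasSum_mul_of_summable (hasSum_theta2 h2) (hasSum_theta2 h2)).neg.congr_fun fun x => ?_
    rw [mul_mul_mul_comm, ← zpow_add₀ (by norm_num),
      Odd.neg_one_zpow ⟨x.1, by ring⟩, neg_one_mul, ← exp_add, ← exp_add]
    push_cast
    ring_nf

theorem theta2_sq {y : ℝ} (hy : 0 < y) :
    theta2 y ^ 2 = 2 * theta2 (2 * y) * theta3 (2 * y) := by
  have h2 : 0 < 2 * y := by positivity
  rw [mul_assoc, two_mul]
  refine sq_eq_of_hasSum_sumDiff (hasSum_theta2 hy) (summable_norm_exp_shift hy _) ?_ ?_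
  · convert hasSum_mul_of_summable (hasSum_theta2 h2) (hasSum_theta3 h2) using 2 with x
    rw [← exp_add, ← exp_add]
    push_cast
    ring_nf
  · rw [mul_comm (theta2 _)]
    have h3 := (Equiv.addRight (1 : ℤ)).hasSum_iff.2 (hasSum_theta3 h2)
    convert hasSum_mul_of_summable h3 (hasSum_theta2 h2) using 2 with x
    simp only [Function.comp_apply, Equiv.coe_addRight]
    rw [← exp_add, ← exp_add]
    push_cast
    ring_nf

/-- Jacobi's identity `θ₃⁴ = θ₂⁴ + θ₄⁴`. -/
theorem theta3_pow_four {y : ℝ} (hy : 0 < y) : theta3 y ^ 4 = theta2 y ^ 4 + theta4 y ^ 4 := by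
  have e (x : ℝ) : x ^ 4 = (x ^ 2) ^ 2 := by ring
  rw [e, e (theta2 y), e (theta4 y), theta2_sq hy, theta3_sq hy, theta4_sq hy]
  ring

/-- The point of `a (1, …, 1) + ℤⁿ` with integer part `v`. -/
noncomputable def shiftedPoint {n : ℕ} (a : ℝ) (v : Fin n → ℤ) : EuclideanSpace ℝ (Fin n) :=
  WithLp.toLp 2 fun i => (v i : ℝ) + a

theorem shiftedPoint_injective {n : ℕ} (a : ℝ) :
    Function.Injective (shiftedPoint (n := n) a) := by
  intro v w h
  funext i
  have := congrArg (fun x : EuclideanSpace ℝ (Fin n) => x i) h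
  simpa [shiftedPoint] using this

theorem exp_norm_shiftedPoint {n : ℕ} (y a : ℝ) (v : Fin n → ℤ) :
    exp (-π * y * ‖shiftedPoint a v‖ ^ 2) = ∏ i, exp (-π * y * ((v i : ℝ) + a) ^ 2) := by
  rw [EuclideanSpace.real_norm_sq_eq, Finset.mul_sum, exp_sum]
  rfl

theorem D12plus_eq_union :
    D12plus = shiftedPoint 0 '' {v | Even (∑ i, v i)} ∪
      shiftedPoint (1 / 2) '' {v | Even (∑ i, v i)} := by
  ext x
  constructor
  · rintro ⟨h | h, m, hm⟩ <;> choose v hv using h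
    · refine Or.inl ⟨v, ⟨m, ?_⟩, ?_⟩
      · simp only [hv] at hm
        rw [← two_mul]
        exact_mod_cast hm
      · ext i
        simp [shiftedPoint, hv]
    · refine Or.inr ⟨v, ⟨m - 3, ?_⟩, ?_⟩
      · simp only [hv, Finset.sum_add_distrib, Finset.sum_const, Finset.card_univ,
          Fintype.card_fin, nsmul_eq_mul] at hm
        have : (∑ i, (v i : ℝ)) = 2 * (m : ℝ) - 6 := by linarith
        have : ∑ i, v i = 2 * m - 6 := by exact_mod_cast this
        omega
      · ext i
        simp [shiftedPoint, hv]
  · rintro (⟨v, ⟨m, hm⟩, rfl⟩ | ⟨v, ⟨m, hm⟩, rfl⟩) <;>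
      have hm' : (∑ i, (v i : ℝ)) = m + m := by exact_mod_cast hm
    · refine ⟨Or.inl fun i => ⟨v i, by simp [shiftedPoint]⟩, m, ?_⟩
      simp [shiftedPoint, hm', two_mul]
    · refine ⟨Or.inr fun i => ⟨v i, by simp [shiftedPoint]⟩, m + 3, ?_⟩
      simp only [shiftedPoint, Finset.sum_add_distrib, hm', Finset.sum_const, Finset.card_univ,
        Fintype.card_fin, nsmul_eq_mul]
      push_cast
      ring

theorem disjoint_shiftedPoint_zero_half {n : ℕ} [NeZero n] (s t : Set (Fin n → ℤ)) :
    Disjoint (shiftedPoint 0 '' s) (shiftedPoint (1 / 2) '' t) := by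
  rw [Set.disjoint_left]
  rintro _ ⟨v, -, rfl⟩ ⟨w, -, h⟩
  have h0 : (w 0 : ℝ) + 1 / 2 = (v 0 : ℝ) + 0 :=
    congrArg (fun x : EuclideanSpace ℝ (Fin n) => x 0) h
  have h1 : 2 * (w 0 : ℝ) + 1 = 2 * (v 0 : ℝ) := by linarith
  have h2 : 2 * w 0 + 1 = 2 * v 0 := by exact_mod_cast h1
  omega

/-- The Gaussian sum over the points of `a (1, …, 1) + ℤⁿ` whose integer part has even sum. -/
theorem hasSum_shiftedPoint_even {n : ℕ} {y a s t : ℝ}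
    (hs : HasSum (fun m : ℤ => exp (-π * y * ((m : ℝ) + a) ^ 2)) s)
    (ht : HasSum (fun m : ℤ => (-1 : ℝ) ^ m * exp (-π * y * ((m : ℝ) + a) ^ 2)) t) :
    HasSum ((fun x : EuclideanSpace ℝ (Fin n) => exp (-π * y * ‖x‖ ^ 2)) ∘
      ((↑) : shiftedPoint a '' {v : Fin n → ℤ | Even (∑ i, v i)} → EuclideanSpace ℝ (Fin n)))
      ((s ^ n + t ^ n) / 2) := by
  rw [← (Equiv.Set.image _ _ (shiftedPoint_injective a)).hasSum_iff]
  refine (hasSum_prod_even hs ht hs.summable.norm n).congr_fun fun v => ?_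
  rw [Function.comp_apply, Function.comp_apply, Equiv.Set.image_apply, exp_norm_shiftedPoint]

/-- The theta series of D₁₂⁺ on the imaginary axis equals θ₃(y)¹² − 24 θ₃(y)⁴ Δ₈(y). -/
theorem theta_series_D12plus (y : ℝ) (hy : 0 < y) :
    (∑' x : D12plus, Real.exp (-π * y * ‖(x : EuclideanSpace ℝ (Fin 12))‖^2)) =
      theta3 y ^ 12 - 24 * theta3 y ^ 4 * Delta8 y := by
  have h0 := hasSum_shiftedPoint_even (n := 12) (a := 0) (by simpa using hasSum_theta3 hy)
    (by simpa using hasSum_theta4 hy)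
  have h1 := hasSum_shiftedPoint_even (n := 12) (hasSum_theta2 hy) (hasSum_theta1 hy)
  have h := (h0.add_disjoint (disjoint_shiftedPoint_zero_half _ _) h1).tsum_eq
  rw [← D12plus_eq_union] at h
  refine h.trans ?_
  have e (x : ℝ) : x ^ 12 = (x ^ 4) ^ 3 := by ring
  rw [Delta8, e, e (theta4 y), e (theta2 y), theta3_pow_four hy]
  ring
end

section
/- (Secrecy gain of D₁₂⁺.) Let D₁₂⁺ ⊆ ℝ¹² be the set of vectors x such that (all coordinates of x are integers, or all coordinates of x lie in ℤ + 1/2) and ∑_i x_i is an even integer. Then for every real y > 0, the secrecy function Ξ(y) = θ₃(y)¹² / (∑_{x ∈ D₁₂⁺} e^{-π y ‖x‖²}) satisfies Ξ(y) ≤ 8/5, with equality at y = 1; in particular the secrecy gain of D₁₂⁺ is 8/5 and is achieved at τ = i. -/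
open Real

/-- The product of two absolutely convergent real series. -/
lemma hasSum_mul_of_summable_norm {ι κ : Type*} {f : ι → ℝ} {g : κ → ℝ} {a b : ℝ}
    (hf : HasSum f a) (hg : HasSum g b)
    (hnf : Summable fun i => ‖f i‖) (hng : Summable fun j => ‖g j‖) :
    HasSum (fun p : ι × κ => f p.1 * g p.2) (a * b) := by
  have h : Summable fun p : ι × κ => f p.1 * g p.2 := summable_mul_of_summable_norm hnf hng
  exact HasSum.mul (f := f) (g := g) hf hg h

/-- A finite product of a summable series with itself, over tuples of indices. -/
lemma summable_and_hasSum_prod_pi {f : ℤ → ℝ} {a : ℝ} (hf : HasSum f a)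
    (hn : Summable fun n => ‖f n‖) (k : ℕ) :
    (Summable fun x : Fin k → ℤ => ‖∏ i, f (x i)‖) ∧
      HasSum (fun x : Fin k → ℤ => ∏ i, f (x i)) (a ^ k) := by
  induction k with
  | zero => exact ⟨(hasSum_fintype _).summable, by simp⟩
  | succ k ih =>
    rw [← (Fin.consEquiv fun _ => ℤ).summable_iff, ← (Fin.consEquiv fun _ => ℤ).hasSum_iff,
      pow_succ']
    have h (p : ℤ × (Fin k → ℤ)) :
        ∏ i, f (Fin.consEquiv (fun _ => ℤ) p i) = f p.1 * ∏ i, f (p.2 i) := by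
      simp [Fin.prod_univ_succ, Fin.consEquiv]
    simp only [Function.comp_def, h]
    exact ⟨Summable.mul_norm (f := f) (g := fun x : Fin k → ℤ => ∏ i, f (x i)) hn ih.1,
      hasSum_mul_of_summable_norm (g := fun x : Fin k → ℤ => ∏ i, f (x i)) hf ih.2 hn ih.1⟩

/-- Splitting `ℤ × ℤ` according to the parity of the coordinate sum. -/
lemma hasSum_int_prod_of_parity {F : ℤ × ℤ → ℝ} {A B : ℝ}
    (hA : HasSum (fun p : ℤ × ℤ => F (p.1 + p.2, p.1 - p.2)) A)
    (hB : HasSum (fun p : ℤ × ℤ => F (p.1 + p.2 + 1, p.1 - p.2)) B) :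
    HasSum F (A + B) := by
  let g : (ℤ × ℤ) ⊕ (ℤ × ℤ) → ℤ × ℤ :=
    Sum.elim (fun p => (p.1 + p.2, p.1 - p.2)) (fun p => (p.1 + p.2 + 1, p.1 - p.2))
  have hg : Function.Bijective g := by
    constructor
    · rintro (⟨a, b⟩ | ⟨a, b⟩) (⟨c, d⟩ | ⟨c, d⟩) h <;>
        simp only [g, Sum.elim_inl, Sum.elim_inr, Prod.mk.injEq, Sum.inl.injEq, Sum.inr.injEq,
          reduceCtorEq] at h ⊢ <;> omega
    · rintro ⟨m, n⟩
      rcases Int.even_or_odd' (m + n) with ⟨k, hk | hk⟩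
      · exact ⟨Sum.inl (k, m - k), by simp only [g, Sum.elim_inl, Prod.mk.injEq]; omega⟩
      · exact ⟨Sum.inr (k, m - k - 1), by simp only [g, Sum.elim_inr, Prod.mk.injEq]; omega⟩
  rw [← (Equiv.ofBijective g hg).hasSum_iff]
  exact HasSum.sum (f := F ∘ g) hA hB

/-- The theta series `∑ e^{-π y (n + a)²}` of the shifted lattice `ℤ + a`. -/
noncomputable def thetaShift (a y : ℝ) : ℝ := ∑' n : ℤ, rexp (-π * y * (n + a) ^ 2)

/-- The alternating theta series `∑ (-1)ⁿ e^{-π y (n + a)²}`. -/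
noncomputable def thetaAlt (a y : ℝ) : ℝ :=
  ∑' n : ℤ, (-1 : ℝ) ^ n * rexp (-π * y * (n + a) ^ 2)

lemma summable_thetaShift (a : ℝ) {y : ℝ} (hy : 0 < y) :
    Summable fun n : ℤ => rexp (-π * y * (n + a) ^ 2) := by
  refine (HurwitzZeta.hasSum_int_evenKernel a hy).summable.congr fun n => ?_
  congr 1; ring

lemma summable_norm_thetaShift (a : ℝ) {y : ℝ} (hy : 0 < y) :
    Summable fun n : ℤ => ‖rexp (-π * y * (n + a) ^ 2)‖ :=
  (summable_thetaShift a hy).norm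

lemma summable_norm_thetaAlt (a : ℝ) {y : ℝ} (hy : 0 < y) :
    Summable fun n : ℤ => ‖(-1 : ℝ) ^ n * rexp (-π * y * (n + a) ^ 2)‖ := by
  simpa [norm_zpow] using summable_thetaShift a hy

lemma hasSum_thetaShift (a : ℝ) {y : ℝ} (hy : 0 < y) :
    HasSum (fun n : ℤ => rexp (-π * y * (n + a) ^ 2)) (thetaShift a y) :=
  (summable_thetaShift a hy).hasSum

lemma hasSum_thetaAlt (a : ℝ) {y : ℝ} (hy : 0 < y) :
    HasSum (fun n : ℤ => (-1 : ℝ) ^ n * rexp (-π * y * (n + a) ^ 2)) (thetaAlt a y) :=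
  (summable_norm_thetaAlt a hy).of_norm.hasSum

lemma hasSum_thetaShift_mul (a b : ℝ) {y : ℝ} (hy : 0 < y) :
    HasSum (fun p : ℤ × ℤ => rexp (-π * y * (p.1 + a) ^ 2) * rexp (-π * y * (p.2 + b) ^ 2))
      (thetaShift a y * thetaShift b y) :=
  hasSum_mul_of_summable_norm (hasSum_thetaShift a hy) (hasSum_thetaShift b hy)
    (summable_norm_thetaShift a hy) (summable_norm_thetaShift b hy)

lemma hasSum_thetaAlt_mul (a b : ℝ) {y : ℝ} (hy : 0 < y) :
    HasSum (fun p : ℤ × ℤ => ((-1 : ℝ) ^ p.1 * rexp (-π * y * (p.1 + a) ^ 2)) *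
      ((-1 : ℝ) ^ p.2 * rexp (-π * y * (p.2 + b) ^ 2))) (thetaAlt a y * thetaAlt b y) :=
  hasSum_mul_of_summable_norm (hasSum_thetaAlt a hy) (hasSum_thetaAlt b hy)
    (summable_norm_thetaAlt a hy) (summable_norm_thetaAlt b hy)

lemma thetaShift_add_one (a y : ℝ) : thetaShift (a + 1) y = thetaShift a y := by
  unfold thetaShift
  rw [← (Equiv.addRight (1 : ℤ)).tsum_eq fun n : ℤ => rexp (-π * y * (n + a) ^ 2)]
  refine tsum_congr fun n => ?_
  simp only [Equiv.coe_addRight]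
  push_cast
  congr 1; ring

lemma thetaShift_pos (a : ℝ) {y : ℝ} (hy : 0 < y) : 0 < thetaShift a y :=
  (summable_thetaShift a hy).tsum_pos (fun _ => (exp_pos _).le) 0 (exp_pos _)

lemma theta3_eq_thetaShift (y : ℝ) : theta3 y = thetaShift 0 y := by
  simp [theta3, thetaShift]

/-- `θ₁` vanishes at the origin. -/
lemma thetaAlt_half (y : ℝ) : thetaAlt (1 / 2) y = 0 := by
  have h : thetaAlt (1 / 2) y = -thetaAlt (1 / 2) y := by
    conv_lhs => unfold thetaAlt
    rw [← (Equiv.subLeft (-1 : ℤ)).tsum_eq, thetaAlt, ← tsum_neg]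
    refine tsum_congr fun n => ?_
    simp only [Equiv.subLeft_apply]
    rw [zpow_sub₀ (by norm_num), ← neg_mul]
    push_cast
    congr 1
    · rcases Int.even_or_odd n with h | h <;> simp [h.neg_one_zpow]
    · congr 1; ring
  linarith

/-- `θ₃(τ)² = θ₃(2τ)² + θ₂(2τ)²`. -/
lemma thetaShift_zero_sq {y : ℝ} (hy : 0 < y) :
    thetaShift 0 y ^ 2 = thetaShift 0 (2 * y) ^ 2 + thetaShift (1 / 2) (2 * y) ^ 2 := by
  have hy' : 0 < 2 * y := by positivity
  simp only [sq]
  refine (hasSum_thetaShift_mul 0 0 hy).unique (hasSum_int_prod_of_parity ?_ ?_)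
  · refine (hasSum_thetaShift_mul 0 0 hy').congr_fun fun p => ?_
    rw [← Real.exp_add, ← Real.exp_add]
    push_cast
    congr 1; ring
  · refine (hasSum_thetaShift_mul (1 / 2) (1 / 2) hy').congr_fun fun p => ?_
    rw [← Real.exp_add, ← Real.exp_add]
    push_cast
    congr 1; ring

/-- `θ₄(τ)² = θ₃(2τ)² - θ₂(2τ)²`. -/
lemma thetaAlt_zero_sq {y : ℝ} (hy : 0 < y) :
    thetaAlt 0 y ^ 2 = thetaShift 0 (2 * y) ^ 2 - thetaShift (1 / 2) (2 * y) ^ 2 := by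
  have hy' : 0 < 2 * y := by positivity
  simp only [sq, sub_eq_add_neg]
  refine (hasSum_thetaAlt_mul 0 0 hy).unique (hasSum_int_prod_of_parity ?_ ?_)
  · refine (hasSum_thetaShift_mul 0 0 hy').congr_fun fun p => ?_
    have h : (-1 : ℝ) ^ (p.1 + p.2) * (-1) ^ (p.1 - p.2) = 1 := by
      rw [← zpow_add₀ (by norm_num), Even.neg_one_zpow ⟨p.1, by ring⟩]
    rw [mul_mul_mul_comm, h, one_mul, ← Real.exp_add, ← Real.exp_add]
    push_cast
    congr 1; ring
  · refine (hasSum_thetaShift_mul (1 / 2) (1 / 2) hy').neg.congr_fun fun p => ?_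
    have h : (-1 : ℝ) ^ (p.1 + p.2 + 1) * (-1) ^ (p.1 - p.2) = -1 := by
      rw [← zpow_add₀ (by norm_num), Odd.neg_one_zpow ⟨p.1, by ring⟩]
    rw [mul_mul_mul_comm, h, neg_one_mul, ← Real.exp_add, ← Real.exp_add]
    push_cast
    congr 2; ring

/-- `θ₂(τ)² = 2 θ₂(2τ) θ₃(2τ)`. -/
lemma thetaShift_half_sq {y : ℝ} (hy : 0 < y) :
    thetaShift (1 / 2) y ^ 2 = 2 * (thetaShift (1 / 2) (2 * y) * thetaShift 0 (2 * y)) := by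
  have hy' : 0 < 2 * y := by positivity
  have h1 : thetaShift 1 (2 * y) = thetaShift 0 (2 * y) := by
    simpa using thetaShift_add_one 0 (2 * y)
  have key : thetaShift (1 / 2) y * thetaShift (1 / 2) y =
      thetaShift (1 / 2) (2 * y) * thetaShift 0 (2 * y) +
        thetaShift 1 (2 * y) * thetaShift (1 / 2) (2 * y) := by
    refine (hasSum_thetaShift_mul (1 / 2) (1 / 2) hy).unique (hasSum_int_prod_of_parity ?_ ?_)
    · refine (hasSum_thetaShift_mul (1 / 2) 0 hy').congr_fun fun p => ?_
      rw [← Real.exp_add, ← Real.exp_add]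
      push_cast
      congr 1; ring
    · refine (hasSum_thetaShift_mul 1 (1 / 2) hy').congr_fun fun p => ?_
      rw [← Real.exp_add, ← Real.exp_add]
      push_cast
      congr 1; ring
  rw [sq, key, h1]
  ring

/-- The Jacobi identity `θ₃⁴ = θ₂⁴ + θ₄⁴`. -/
lemma jacobi_identity {y : ℝ} (hy : 0 < y) :
    thetaShift 0 y ^ 4 = thetaShift (1 / 2) y ^ 4 + thetaAlt 0 y ^ 4 := by
  have e (x : ℝ) : x ^ 4 = (x ^ 2) ^ 2 := by ring
  rw [e, e (thetaShift _ y), e (thetaAlt _ _), thetaShift_zero_sq hy, thetaAlt_zero_sq hy,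
    thetaShift_half_sq hy]
  ring

/-- `θ₂(i) = θ₄(i)`. -/
lemma thetaShift_half_one : thetaShift (1 / 2) 1 = thetaAlt 0 1 := by
  have h1 := HurwitzZeta.hasSum_int_evenKernel (1 / 2) one_pos
  have h2 := HurwitzZeta.hasSum_int_cosKernel (1 / 2) one_pos
  have h3 := HurwitzZeta.evenKernel_functional_equation ((1 / 2 : ℝ) : UnitAddCircle) 1
  simp only [one_rpow, div_one, one_mul] at h3
  rw [h3] at h1
  have h4 : HasSum (fun n : ℤ => (-1 : ℝ) ^ n * rexp (-π * 1 * (n + 0) ^ 2))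
      (HurwitzZeta.cosKernel ((1 / 2 : ℝ) : UnitAddCircle) 1) := by
    rw [← Complex.hasSum_ofReal]
    refine h2.congr_fun fun n => ?_
    have : Complex.exp (2 * π * Complex.I * ((1 / 2 : ℝ) : ℂ) * n) = (-1) ^ n := by
      rw [← Complex.exp_pi_mul_I, ← Complex.exp_int_mul]
      congr 1; push_cast; ring
    rw [this, Complex.ofReal_mul, Complex.ofReal_zpow]
    push_cast
    congr 2; ring
  rw [← (hasSum_thetaAlt 0 one_pos).unique h4] at h1
  refine ((hasSum_thetaShift (1 / 2) one_pos).unique (h1.congr_fun fun n => ?_))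
  congr 1; ring

/-- The theta series of the vectors of `(ℤ + a)ᵏ` whose integral parts have even sum. -/
lemma hasSum_even_prod (a : ℝ) {y : ℝ} (hy : 0 < y) (k : ℕ) :
    HasSum (fun x : {x : Fin k → ℤ | Even (∑ i, x i)} =>
      ∏ i, rexp (-π * y * ((x : Fin k → ℤ) i + a) ^ 2))
      ((thetaShift a y ^ k + thetaAlt a y ^ k) / 2) := by
  have h1 := (summable_and_hasSum_prod_pi (hasSum_thetaShift a hy)
    (summable_norm_thetaShift a hy) k).2
  have h2 := (summable_and_hasSum_prod_pi (hasSum_thetaAlt a hy)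
    (summable_norm_thetaAlt a hy) k).2
  have hind := hasSum_subtype_iff_indicator (s := {x : Fin k → ℤ | Even (∑ i, x i)})
    (f := fun x => ∏ i, rexp (-π * y * (x i + a) ^ 2))
    (a := (thetaShift a y ^ k + thetaAlt a y ^ k) / 2)
  refine hind.2 (((h1.add h2).div_const 2).congr_fun fun x => ?_)
  have hs (s : Finset (Fin k)) : ∏ i ∈ s, (-1 : ℝ) ^ x i = (-1) ^ ∑ i ∈ s, x i := by
    classical
    induction s using Finset.induction_on with
    | empty => simp
    | insert i s hi ih => rw [Finset.prod_insert hi, Finset.sum_insert hi, ih,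
        zpow_add₀ (by norm_num)]
  rw [Finset.prod_mul_distrib, hs]
  rcases Int.even_or_odd (∑ i, x i) with h | h
  · rw [Set.indicator_of_mem (by exact h), h.neg_one_zpow]
    ring
  · rw [Set.indicator_of_notMem (by simpa using h), h.neg_one_zpow]
    ring

/-- The integral and the half-integral vectors of `D₁₂⁺`, indexed by their integral parts. -/
noncomputable def toD12plus (p : {x : Fin 12 → ℤ | Even (∑ i, x i)} ⊕
    {x : Fin 12 → ℤ | Even (∑ i, x i)}) : D12plus :=
  p.elim
    (fun x : {x : Fin 12 → ℤ | Even (∑ i, x i)} => ⟨WithLp.toLp 2 fun i => ((x : Fin 12 → ℤ) i : ℝ),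
      Or.inl fun i => ⟨(x : Fin 12 → ℤ) i, rfl⟩, by
      obtain ⟨x, m, hm⟩ := x
      exact ⟨m, by
        have : ((∑ i, x i : ℤ) : ℝ) = m + m := by exact_mod_cast hm
        push_cast at this
        simp only [this]; ring⟩⟩)
    (fun x : {x : Fin 12 → ℤ | Even (∑ i, x i)} =>
      ⟨WithLp.toLp 2 fun i => ((x : Fin 12 → ℤ) i : ℝ) + 1 / 2,
      Or.inr fun i => ⟨(x : Fin 12 → ℤ) i, rfl⟩, by
      obtain ⟨x, m, hm⟩ := x
      exact ⟨m + 3, by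
        have : ((∑ i, x i : ℤ) : ℝ) = m + m := by exact_mod_cast hm
        push_cast at this
        simp only [Finset.sum_add_distrib, this]
        simp; ring⟩⟩)

lemma toD12plus_bijective : Function.Bijective toD12plus := by
  have hne (m n : ℤ) : (m : ℝ) ≠ n + 1 / 2 := fun h => by
    have : (2 * m : ℝ) = 2 * n + 1 := by linarith
    have : 2 * m = 2 * n + 1 := by exact_mod_cast this
    omega
  constructor
  · rintro (⟨x, hx⟩ | ⟨x, hx⟩) (⟨z, hz⟩ | ⟨z, hz⟩) h <;>
      replace h := fun i => congrArg (fun v : D12plus => (v : EuclideanSpace ℝ (Fin 12)) i) h <;>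
      simp only [toD12plus, Sum.elim_inl, Sum.elim_inr] at h
    · congr 2; ext i; exact_mod_cast h i
    · exact absurd (h 0) (hne _ _)
    · exact absurd (h 0).symm (hne _ _)
    · congr 2; ext i; simpa using h i
  · rintro ⟨x, h | h, m, hm⟩
    · obtain ⟨z, hz⟩ := Classical.skolem.1 h
      refine ⟨Sum.inl ⟨z, m, ?_⟩, Subtype.ext ?_⟩
      · simp only [hz] at hm
        have : ∑ i, z i = 2 * m := by exact_mod_cast hm
        omega
      · ext i; exact (hz i).symm
    · obtain ⟨z, hz⟩ := Classical.skolem.1 h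
      refine ⟨Sum.inr ⟨z, m - 3, ?_⟩, Subtype.ext ?_⟩
      · simp only [hz, Finset.sum_add_distrib] at hm
        have hm' : (∑ i, (z i : ℝ)) = 2 * (m - 3) := by
          simp at hm; linarith
        have : ∑ i, z i = 2 * (m - 3) := by exact_mod_cast hm'
        omega
      · ext i; exact (hz i).symm

/-- `Θ_{D₁₂⁺} = (θ₂¹² + θ₃¹² + θ₄¹²) / 2`. -/
lemma tsum_D12plus {y : ℝ} (hy : 0 < y) :
    ∑' x : D12plus, rexp (-π * y * ‖(x : EuclideanSpace ℝ (Fin 12))‖ ^ 2) =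
      (thetaShift 0 y ^ 12 + thetaShift (1 / 2) y ^ 12 + thetaAlt 0 y ^ 12) / 2 := by
  have h : HasSum (fun x : D12plus => rexp (-π * y * ‖(x : EuclideanSpace ℝ (Fin 12))‖ ^ 2))
      ((thetaShift 0 y ^ 12 + thetaAlt 0 y ^ 12) / 2 +
        (thetaShift (1 / 2) y ^ 12 + thetaAlt (1 / 2) y ^ 12) / 2) := by
    rw [← (Equiv.ofBijective _ toD12plus_bijective).hasSum_iff]
    refine HasSum.sum (f := (fun x : D12plus =>
      rexp (-π * y * ‖(x : EuclideanSpace ℝ (Fin 12))‖ ^ 2)) ∘ toD12plus) ?_ ?_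
    · refine (hasSum_even_prod 0 hy 12).congr_fun fun x => ?_
      simp [toD12plus, EuclideanSpace.norm_sq_eq, Finset.mul_sum, ← Real.exp_sum]
    · refine (hasSum_even_prod (1 / 2) hy 12).congr_fun fun x => ?_
      simp [toD12plus, EuclideanSpace.norm_sq_eq, Finset.mul_sum, ← Real.exp_sum]
  rw [h.tsum_eq, thetaAlt_half]
  ring

/-- Secrecy gain of D₁₂⁺: the secrecy function Ξ(y) = θ₃(y)¹² / Θ_{D₁₂⁺}(iy) satisfies
Ξ(y) ≤ 8/5 for every y > 0, with equality at y = 1; in particular the secrecy gain of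
D₁₂⁺ is 8/5, achieved at τ = i. -/
theorem secrecy_gain_D12plus :
    (∀ y : ℝ, 0 < y →
      theta3 y ^ 12 / (∑' x : D12plus, Real.exp (-π * y * ‖(x : EuclideanSpace ℝ (Fin 12))‖^2))
        ≤ 8/5) ∧
    theta3 1 ^ 12 / (∑' x : D12plus, Real.exp (-π * 1 * ‖(x : EuclideanSpace ℝ (Fin 12))‖^2))
      = 8/5 := by
  refine ⟨fun y hy => ?_, ?_⟩
  · rw [tsum_D12plus hy, theta3_eq_thetaShift]
    have hJ := jacobi_identity hy
    have h3 := pow_pos (thetaShift_pos 0 hy) 12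
    have h2 : 0 ≤ thetaShift (1 / 2) y ^ 4 := by positivity
    have h4 : 0 ≤ thetaAlt 0 y ^ 4 := by positivity
    have e (x : ℝ) : x ^ 12 = (x ^ 4) ^ 3 := by ring
    rw [div_le_iff₀ (by positivity)]
    rw [e, e (thetaShift (1 / 2) y), e (thetaAlt 0 y), hJ]
    nlinarith [mul_nonneg (add_nonneg h2 h4)
      (sq_nonneg (thetaShift (1 / 2) y ^ 4 - thetaAlt 0 y ^ 4))]
  · rw [tsum_D12plus one_pos, theta3_eq_thetaShift]
    have hJ := jacobi_identity one_pos
    have h3 := pow_pos (thetaShift_pos 0 one_pos) 12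
    have e (x : ℝ) : x ^ 12 = (x ^ 4) ^ 3 := by ring
    rw [div_eq_iff (by positivity)]
    rw [e, e (thetaShift (1 / 2) 1), e (thetaAlt 0 1), hJ, thetaShift_half_one]
    ring
end
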